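/- arXiv:2109.07568 — 2 statements merged into one kernel-verified Lean document; each statement's English description precedes it below -/
import Mathlib

section
/- Let X = X(G, C) be a normal Cayley graph (C closed under conjugation and inverses, not containing the identity). If a vertex g ∈ G is strongly cospectral to the identity vertex 1, then g² = 1 and g lies in the centre of G. -/
open Matrix

/-- `E` is the orthogonal projection onto the eigenspace of `A` for the eigenvalue `μ`. -/
def IsEigenProjection {V : Type*} [Fintype V] (A : Matrix V V ℝ) (μ : ℝ)
    (E : Matrix V V ℝ) : Prop :=
  E * E = E ∧ E.IsSymm ∧
    (∀ x : V → ℝ, A.mulVec (E.mulVec x) = μ • E.mulVec x) ∧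
    (∀ y : V → ℝ, A.mulVec y = μ • y → E.mulVec y = y)

/-- Vertices `u` and `v` are strongly cospectral: `E e_u = ± E e_v` for every spectral
idempotent `E` of `A`. -/
def StronglyCospectral {V : Type*} [Fintype V] [DecidableEq V]
    (A : Matrix V V ℝ) (u v : V) : Prop :=
  ∀ (μ : ℝ) (E : Matrix V V ℝ), IsEigenProjection A μ E →
    E.mulVec (Pi.single u 1) = E.mulVec (Pi.single v 1) ∨
    E.mulVec (Pi.single u 1) = -E.mulVec (Pi.single v 1)

/-- The adjacency matrix of the Cayley graph `X(G, C)`: `g ~ h` iff `h * g⁻¹ ∈ C`. -/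
def cayleyAdj {G : Type*} [Group G] [Fintype G] [DecidableEq G] (C : Finset G) :
    Matrix G G ℝ :=
  Matrix.of fun g h => if h * g⁻¹ ∈ C then 1 else 0

section EigenProjection

variable {V : Type*} [Fintype V] [DecidableEq V]

theorem exists_isEigenProjection {A : Matrix V V ℝ} (hA : A.IsHermitian) (μ : ℝ) :
    ∃ E, IsEigenProjection A μ E := by
  obtain ⟨U, d, hU, hU', hAU⟩ : ∃ (U : Matrix V V ℝ) (d : V → ℝ),
      U * Uᵀ = 1 ∧ Uᵀ * U = 1 ∧ A * U = U * diagonal d := by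
    have hU := Unitary.mul_star_self_of_mem hA.eigenvectorUnitary.2
    have hU' := Unitary.star_mul_self_of_mem hA.eigenvectorUnitary.2
    refine ⟨hA.eigenvectorUnitary, hA.eigenvalues, ?_, ?_, ?_⟩
    · simpa [star_eq_conjTranspose] using hU
    · simpa [star_eq_conjTranspose] using hU'
    · ext a i
      have := congrFun (hA.mulVec_eigenvectorBasis i) a
      rw [mul_diagonal]
      simpa [mul_apply, mulVec, dotProduct, mul_comm] using this
  set p : V → ℝ := fun i => if d i = μ then 1 else 0 with hp
  have hdp : diagonal d * diagonal p = μ • diagonal p := by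
    rw [diagonal_mul_diagonal, ← diagonal_smul]
    congr 1
    ext i
    by_cases h : d i = μ <;> simp [hp, h]
  refine ⟨U * diagonal p * Uᵀ, ?_, ?_, fun x => ?_, fun y hy => ?_⟩
  · have hpp : diagonal p * diagonal p = diagonal p := by
      rw [diagonal_mul_diagonal]
      congr 1
      ext i
      simp [hp]
    calc U * diagonal p * Uᵀ * (U * diagonal p * Uᵀ)
        = U * diagonal p * (Uᵀ * U) * (diagonal p * Uᵀ) := by simp only [Matrix.mul_assoc]
      _ = U * (diagonal p * diagonal p) * Uᵀ := by
        rw [hU', Matrix.mul_one]; simp only [Matrix.mul_assoc]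
      _ = _ := by rw [hpp]
  · simp [Matrix.IsSymm, transpose_mul, Matrix.mul_assoc]
  · have h : A * (U * diagonal p * Uᵀ) = μ • (U * diagonal p * Uᵀ) := by
      rw [← Matrix.mul_assoc, ← Matrix.mul_assoc, hAU, Matrix.mul_assoc U, hdp]
      simp
    rw [mulVec_mulVec, h, smul_mulVec]
  · have hUA : Uᵀ * A = diagonal d * Uᵀ := by
      calc Uᵀ * A = Uᵀ * (A * U) * Uᵀ := by
            rw [Matrix.mul_assoc, Matrix.mul_assoc, hU, Matrix.mul_one]
        _ = Uᵀ * U * (diagonal d * Uᵀ) := by rw [hAU]; simp only [Matrix.mul_assoc]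
        _ = _ := by rw [hU', Matrix.one_mul]
    have hz : diagonal d *ᵥ (Uᵀ *ᵥ y) = μ • (Uᵀ *ᵥ y) := by
      rw [mulVec_mulVec, ← hUA, ← mulVec_mulVec, hy, mulVec_smul]
    have hpz : diagonal p *ᵥ (Uᵀ *ᵥ y) = Uᵀ *ᵥ y := by
      ext i
      have hi := congrFun hz i
      rw [mulVec_diagonal, Pi.smul_apply, smul_eq_mul] at hi
      rw [mulVec_diagonal]
      by_cases h : d i = μ
      · simp [hp, h]
      · have h0 : (Uᵀ *ᵥ y) i = 0 := (mul_eq_mul_right_iff.mp hi).resolve_left h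
        simp [h0]
    rw [← mulVec_mulVec, ← mulVec_mulVec, hpz, mulVec_mulVec, hU, one_mulVec]

theorem IsEigenProjection.apply_eq_dotProduct {A E : Matrix V V ℝ} {μ : ℝ}
    (hE : IsEigenProjection A μ E) {y : V → ℝ} (hy : A *ᵥ y = μ • y) (u : V) :
    y u = y ⬝ᵥ E *ᵥ Pi.single u 1 := by
  rw [dotProduct_mulVec, ← mulVec_transpose, hE.2.1.eq, hE.2.2.2 y hy, dotProduct_single_one]

/-- All eigenvectors for a given eigenvalue relate their entries at two strongly cospectral
vertices by a common sign. -/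
theorem StronglyCospectral.exists_sign {A : Matrix V V ℝ} (hA : A.IsHermitian) {u v : V}
    (h : StronglyCospectral A u v) (μ : ℝ) :
    ∃ ε : ℝ, ε * ε = 1 ∧ ∀ y : V → ℝ, A *ᵥ y = μ • y → y u = ε * y v := by
  obtain ⟨E, hE⟩ := exists_isEigenProjection hA μ
  rcases h μ E hE with h | h
  · refine ⟨1, by norm_num, fun y hy => ?_⟩
    rw [hE.apply_eq_dotProduct hy u, hE.apply_eq_dotProduct hy v, h, one_mul]
  · refine ⟨-1, by norm_num, fun y hy => ?_⟩
    rw [hE.apply_eq_dotProduct hy u, hE.apply_eq_dotProduct hy v, h, dotProduct_neg, neg_one_mul]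

/-- The eigenvectors of a symmetric matrix separate vertices. -/
theorem eq_of_forall_eigenvector_apply_eq {A : Matrix V V ℝ} (hA : A.IsHermitian) {u v : V}
    (h : ∀ (μ : ℝ) (y : V → ℝ), A *ᵥ y = μ • y → y u = y v) : u = v := by
  by_contra huv
  have hU := Unitary.mul_star_self_of_mem hA.eigenvectorUnitary.2
  have hrow : ∀ i, (hA.eigenvectorUnitary : Matrix V V ℝ) u i =
      (hA.eigenvectorUnitary : Matrix V V ℝ) v i := fun i =>
    h _ _ (hA.mulVec_eigenvectorBasis i)
  have huu := congrFun (congrFun hU u) v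
  have hvv := congrFun (congrFun hU v) v
  rw [mul_apply] at huu hvv
  simp only [hrow] at huu
  rw [hvv] at huu
  simp [huv] at huu

end EigenProjection

theorem mulVec_comp_equiv_of_eigenvector {V : Type*} [Fintype V] {A : Matrix V V ℝ} {σ : V ≃ V}
    (hσ : ∀ a b, A (σ a) (σ b) = A a b) {μ : ℝ} {y : V → ℝ} (hy : A *ᵥ y = μ • y) :
    A *ᵥ (y ∘ σ) = μ • (y ∘ σ) := by
  ext a
  have ha := congrFun hy (σ a)
  simp only [mulVec, dotProduct] at ha
  rw [← Equiv.sum_comp σ] at ha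
  simpa [mulVec, dotProduct, hσ] using ha

theorem stmt3 {G : Type*} [Group G] [Fintype G] [DecidableEq G] (C : Finset G)
    (h1 : (1 : G) ∉ C) (hinv : ∀ c ∈ C, c⁻¹ ∈ C)
    (hnorm : ∀ x : G, ∀ c ∈ C, x⁻¹ * c * x ∈ C)
    (g : G) (hg : StronglyCospectral (cayleyAdj C) 1 g) :
    g ^ 2 = 1 ∧ g ∈ Subgroup.center G := by
  have hA : (cayleyAdj C).IsHermitian := by
    ext a b
    have : a * b⁻¹ ∈ C ↔ b * a⁻¹ ∈ C :=
      ⟨fun h => by simpa using hinv _ h, fun h => by simpa using hinv _ h⟩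
    simp [cayleyAdj, this]
  constructor
  · symm
    refine eq_of_forall_eigenvector_apply_eq hA fun μ y hy => ?_
    obtain ⟨ε, hε, hsign⟩ := hg.exists_sign hA μ
    have hright : ∀ a b, cayleyAdj C (Equiv.mulRight g a) (Equiv.mulRight g b) =
        cayleyAdj C a b := fun a b => by simp [cayleyAdj, mul_assoc]
    have h₁ := hsign y hy
    have h₂ := hsign _ (mulVec_comp_equiv_of_eigenvector hright hy)
    simp only [Function.comp_apply, Equiv.coe_mulRight, one_mul, ← pow_two] at h₂
    rw [h₁, h₂, ← mul_assoc, hε, one_mul]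
  · rw [Subgroup.mem_center_iff]
    intro x
    suffices h : g = x * g * x⁻¹ by
      nth_rewrite 2 [h]
      group
    refine eq_of_forall_eigenvector_apply_eq hA fun μ y hy => ?_
    obtain ⟨ε, hε, hsign⟩ := hg.exists_sign hA μ
    have hconj : ∀ a b, cayleyAdj C ((MulAut.conj x).toEquiv a) ((MulAut.conj x).toEquiv b) =
        cayleyAdj C a b := fun a b => by
      have : x * b * x⁻¹ * (x * a * x⁻¹)⁻¹ ∈ C ↔ b * a⁻¹ ∈ C :=
        ⟨fun h => by simpa [mul_assoc] using hnorm x _ h,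
          fun h => by simpa [mul_assoc] using hnorm x⁻¹ _ h⟩
      simp only [cayleyAdj, of_apply, MulEquiv.toEquiv_eq_coe, MulEquiv.coe_toEquiv,
        MulAut.conj_apply, this]
    have h₁ := hsign y hy
    have h₂ := hsign _ (mulVec_comp_equiv_of_eigenvector hconj hy)
    simp only [Function.comp_apply, MulEquiv.toEquiv_eq_coe, MulEquiv.coe_toEquiv,
      MulAut.conj_apply, mul_one, mul_inv_cancel] at h₂
    have hε0 : ε ≠ 0 := fun h => by simp [h] at hε
    exact mul_left_cancel₀ hε0 (h₁.symm.trans h₂)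
end

section
/- Every cubelike graph X(Z_2^d, C) with d ≥ 3 has an eigenvalue whose multiplicity is strictly greater than 2^{d/2}. -/
open Matrix

/-- The adjacency matrix of the Cayley graph `X(G, C)` of an additive group:
`g ~ h` iff `h - g ∈ C`. -/
def addCayleyAdj {G : Type*} [AddGroup G] [Fintype G] [DecidableEq G] (C : Finset G) :
    Matrix G G ℝ :=
  Matrix.of fun g h => if h - g ∈ C then 1 else 0

open Finset

/-- Integers of a fixed parity, each value taken at most `M` times, have a large sum of squares. -/
theorem sq_mul_card_le_sum_sq_add {ι : Type*} (s : Finset ι) (f : ι → ℤ) (K M : ℤ) (c : ℕ)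
    (hc : K = c ∨ K = c + 1) (hpar : ∀ i ∈ s, f i ≡ c [ZMOD 2])
    (hM : ∀ v : ℤ, (#{i ∈ s | f i = v} : ℤ) ≤ M) :
    K ^ 2 * #s ≤ ∑ i ∈ s, f i ^ 2 + M * ∑ j ∈ range (c + 1), (K ^ 2 - (c - 2 * j : ℤ) ^ 2) := by
  have hterm : ∀ j ∈ range (c + 1), 0 ≤ K ^ 2 - (c - 2 * j : ℤ) ^ 2 := by
    intro j hj
    have : j ≤ c := by simpa [Nat.lt_succ_iff] using hj
    have h : (j : ℤ) ≤ c := by exact_mod_cast this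
    rw [sub_nonneg]
    apply sq_le_sq'
    all_goals omega
  have hpt : ∀ i ∈ s, K ^ 2 - f i ^ 2 ≤
      ∑ j ∈ range (c + 1), if f i = c - 2 * j then K ^ 2 - (c - 2 * j : ℤ) ^ 2 else 0 := by
    intro i hi
    have hnn : ∀ j ∈ range (c + 1),
        0 ≤ if f i = c - 2 * j then K ^ 2 - (c - 2 * j : ℤ) ^ 2 else 0 := fun j hj => by
      split_ifs
      exacts [hterm j hj, le_rfl]
    by_cases hlarge : |f i| ≤ c
    · obtain ⟨h1, h2⟩ := abs_le.mp hlarge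
      have hm := hpar i hi
      unfold Int.ModEq at hm
      obtain ⟨j, hj⟩ : ∃ j : ℕ, f i = c - 2 * j := ⟨((c - f i) / 2).toNat, by omega⟩
      refine le_trans ?_ (single_le_sum hnn (mem_range.mpr (by omega : j < c + 1)))
      simp [hj]
    · refine le_trans ?_ (sum_nonneg hnn)
      rw [sub_nonpos]
      apply sq_le_sq.mpr
      have : |K| = K := abs_of_nonneg (by omega)
      omega
  have := sum_le_sum hpt
  rw [sum_comm, sum_sub_distrib, sum_const, nsmul_eq_mul] at this
  have h2 : ∑ j ∈ range (c + 1), ∑ i ∈ s,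
      (if f i = c - 2 * j then K ^ 2 - (c - 2 * j : ℤ) ^ 2 else 0) ≤
      M * ∑ j ∈ range (c + 1), (K ^ 2 - (c - 2 * j : ℤ) ^ 2) := by
    rw [mul_sum]
    refine sum_le_sum fun j hj => ?_
    rw [← sum_filter, sum_const, nsmul_eq_mul]
    exact mul_le_mul_of_nonneg_right (hM _) (hterm j hj)
  linarith

theorem three_mul_sum_sq_sub (K c : ℤ) (m : ℕ) :
    3 * ∑ j ∈ range m, (K ^ 2 - (c - 2 * j : ℤ) ^ 2) =
      3 * m * (K ^ 2 - c ^ 2) + 6 * c * m * (m - 1) - 2 * m * (m - 1) * (2 * m - 1) := by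
  induction m with
  | zero => simp
  | succ m ih => rw [sum_range_succ, mul_add, ih]; push_cast; ring

theorem three_mul_sq_mul_card_le {ι : Type*} (s : Finset ι) (f : ι → ℤ) (n M : ℤ)
    (hpar : ∀ i ∈ s, f i ≡ n [ZMOD 2]) (hM : ∀ v : ℤ, (#{i ∈ s | f i = v} : ℤ) ≤ M)
    (K : ℕ) (hK : 1 ≤ K) :
    3 * K ^ 2 * #s ≤ 3 * ∑ i ∈ s, f i ^ 2 +
      M * if n ≡ K [ZMOD 2] then (2 * K * (K ^ 2 - 1) : ℤ) else (2 * K ^ 3 + K : ℤ) := by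
  split_ifs with h
  · have h1 := sq_mul_card_le_sum_sq_add s f K M K (Or.inl rfl)
      (fun i hi => (hpar i hi).trans h) hM
    have h2 := three_mul_sum_sq_sub K K (K + 1)
    push_cast at h2
    linear_combination 3 * h1 + M * h2
  · obtain ⟨c, rfl⟩ := Nat.exists_eq_add_of_le' hK
    have h1 := sq_mul_card_le_sum_sq_add s f (c + 1 : ℕ) M c (Or.inr (by simp))
      (fun i hi => (hpar i hi).trans (by unfold Int.ModEq at *; omega)) hM
    have h2 := three_mul_sum_sq_sub (c + 1 : ℕ) c (c + 1)
    push_cast at h1 h2 ⊢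
    linear_combination 3 * h1 + M * h2

/-- Some value is taken more than `2 ^ (d / 2)` times by `2 ^ d - 1` integers of equal parity
whose squares sum to `n * (2 ^ d - n)`. -/
theorem exists_two_pow_lt_card_sq {ι : Type*} (s : Finset ι) (f : ι → ℤ) (n : ℤ) (d : ℕ)
    (hd : 3 ≤ d) (hcard : (#s : ℤ) = 2 ^ d - 1) (hpar : ∀ i ∈ s, f i ≡ n [ZMOD 2])
    (hsum : ∑ i ∈ s, f i ^ 2 = n * (2 ^ d - n)) :
    ∃ v : ℤ, 2 ^ d < #{i ∈ s | f i = v} ^ 2 := by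
  by_contra! hcon
  have hM : ∀ v : ℤ, (#{i ∈ s | f i = v} : ℤ) ≤ (Nat.sqrt (2 ^ d) : ℕ) := fun v => by
    exact_mod_cast Nat.le_sqrt'.mpr (hcon v)
  have hM2 : ((Nat.sqrt (2 ^ d) : ℕ) : ℤ) ^ 2 ≤ 2 ^ d := by
    exact_mod_cast Nat.sqrt_le' (2 ^ d)
  generalize hMdef : ((Nat.sqrt (2 ^ d) : ℕ) : ℤ) = M at hM hM2
  have hM0 : 0 ≤ M := by omega
  have key := three_mul_sq_mul_card_le s f n M hpar hM
  rw [hsum, hcard] at key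
  clear hcon hM hMdef
  -- The weaker bound that does not depend on parities.
  have key' : ∀ K : ℕ, 1 ≤ K → 3 * (K : ℤ) ^ 2 * (2 ^ d - 1) ≤
      3 * (n * (2 ^ d - n)) + M * (2 * K ^ 3 + K) := fun K hK => by
    refine (key K hK).trans ?_
    gcongr
    split_ifs
    · nlinarith
    · rfl
  have hn : 4 * (n * (2 ^ d - n)) ≤ (2 ^ d : ℤ) ^ 2 := by
    linarith [sq_nonneg (2 ^ d - 2 * n : ℤ)]
  obtain ⟨e, rfl | rfl⟩ := Nat.even_or_odd' d
  · obtain ⟨Q, hQ⟩ : ∃ Q : ℕ, Q = 2 ^ e := ⟨_, rfl⟩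
    have hN : (2 : ℤ) ^ (2 * e) = (Q : ℤ) ^ 2 := by rw [hQ]; push_cast; ring
    rw [hN] at hM2 hn
    simp only [hN] at key key'
    have hMQ : M ≤ Q := le_of_sq_le_sq hM2 (by positivity)
    obtain rfl | he : e = 2 ∨ 3 ≤ e := by omega
    · norm_num at hQ
      subst hQ
      have h := key 4 (by norm_num)
      split_ifs at h with hpar4
      · push_cast at *
        linarith
      · have hodd : n ≠ 8 := by
          rintro rfl
          exact hpar4 rfl
        have : 1 ≤ (n - 8) ^ 2 := by
          have : 0 < (n - 8) ^ 2 := by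
            have : n - 8 ≠ 0 := by omega
            positivity
          omega
        push_cast at *
        linarith
    · have hQ8 : (8 : ℤ) ≤ Q := by
        rw [hQ]; exact_mod_cast Nat.pow_le_pow_right (n := 2) (by norm_num) he
      have h := key' Q (by omega)
      have h1 : M * (2 * (Q : ℤ) ^ 3 + Q) ≤ Q * (2 * (Q : ℤ) ^ 3 + Q) := by gcongr
      have h2 : (64 : ℤ) ≤ Q ^ 2 := by nlinarith
      nlinarith [mul_le_mul_of_nonneg_left h2 (sq_nonneg (Q : ℤ))]
  · obtain rfl | he : e = 1 ∨ 2 ≤ e := by omega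
    · have hM2' : M ≤ 2 := by norm_num at hM2; nlinarith
      have h := key' 3 (by norm_num)
      push_cast at *
      linarith
    · obtain ⟨e, rfl⟩ := Nat.exists_eq_add_of_le' he
      obtain ⟨P, hP⟩ : ∃ P : ℕ, P = 2 ^ e := ⟨_, rfl⟩
      have hP1 : (1 : ℤ) ≤ P := by
        rw [hP]; exact_mod_cast Nat.one_le_two_pow
      have hN : (2 : ℤ) ^ (2 * (e + 2) + 1) = 32 * (P : ℤ) ^ 2 := by rw [hP]; push_cast; ring
      rw [hN] at hM2 hn
      simp only [hN] at key'
      have hMP : 3 * M ≤ 17 * P := le_of_sq_le_sq (by nlinarith) (by positivity)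
      have h := key' (6 * P) (by omega)
      push_cast at h
      have h1 : 3 * M * (2 * (6 * P : ℤ) ^ 3 + 6 * P) ≤ 17 * P * (2 * (6 * P : ℤ) ^ 3 + 6 * P) := by
        gcongr
      have h2 : (1 : ℤ) ≤ P ^ 2 := by nlinarith
      nlinarith [mul_le_mul_of_nonneg_left h2 (sq_nonneg (P : ℤ))]

/-- The nontrivial additive character of `ZMod 2`. -/
def signChar : AddChar (ZMod 2) ℤ where
  toFun z := if z = 0 then 1 else -1
  map_zero_eq_one' := rfl
  map_add_eq_mul' := by decide

/-- The character `x ↦ (-1) ^ (y ⬝ᵥ x)` of `Z_2 ^ d`. -/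
def dotChar {d : ℕ} (y : Fin d → ZMod 2) : AddChar (Fin d → ZMod 2) ℤ where
  toFun x := signChar (y ⬝ᵥ x)
  map_zero_eq_one' := by simp
  map_add_eq_mul' a b := by rw [dotProduct_add, AddChar.map_add_eq_mul]

theorem dotChar_apply {d : ℕ} (y x : Fin d → ZMod 2) : dotChar y x = signChar (y ⬝ᵥ x) := rfl

theorem dotChar_comm {d : ℕ} (y x : Fin d → ZMod 2) : dotChar y x = dotChar x y := by
  rw [dotChar_apply, dotChar_apply, dotProduct_comm]

theorem dotChar_zero_apply {d : ℕ} (x : Fin d → ZMod 2) : dotChar 0 x = 1 := by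
  rw [dotChar_comm, AddChar.map_zero_eq_one]

theorem signChar_injective : Function.Injective signChar := by decide

theorem dotChar_injective (d : ℕ) : Function.Injective (dotChar (d := d)) := by
  intro y z h
  funext i
  simpa [dotChar_apply, signChar_injective.eq_iff] using DFunLike.congr_fun h (Pi.single i 1)

theorem sum_dotChar {d : ℕ} (x : Fin d → ZMod 2) :
    ∑ y, dotChar y x = if x = 0 then 2 ^ d else 0 := by
  classical
  have h0 : dotChar x = 0 ↔ x = 0 := by
    rw [← (dotChar_injective d).eq_iff]
    have : dotChar (0 : Fin d → ZMod 2) = 0 := by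
      ext z
      simp [dotChar_zero_apply]
    rw [this]
  simp_rw [dotChar_comm _ x, AddChar.sum_eq_ite, h0]
  simp

/-- The sum of the character `dotChar y` over `C`. -/
def charSum {d : ℕ} (C : Finset (Fin d → ZMod 2)) (y : Fin d → ZMod 2) : ℤ :=
  ∑ c ∈ C, dotChar y c

theorem charSum_zero {d : ℕ} (C : Finset (Fin d → ZMod 2)) : charSum C 0 = #C := by
  simp [charSum, dotChar_zero_apply]

theorem charSum_modEq {d : ℕ} (C : Finset (Fin d → ZMod 2)) (y : Fin d → ZMod 2) :
    charSum C y ≡ #C [ZMOD 2] := by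
  have hsign : ∀ z, signChar z ≡ 1 [ZMOD 2] := by decide
  have h : charSum C y ≡ ∑ c ∈ C, 1 [ZMOD 2] := by
    unfold charSum
    exact Int.ModEq.sum fun c _ => hsign _
  simpa using h

/-- The Parseval identity for the indicator function of `C`. -/
theorem sum_charSum_sq {d : ℕ} (C : Finset (Fin d → ZMod 2)) :
    ∑ y, charSum C y ^ 2 = #C * 2 ^ d := by
  have h : ∀ y, charSum C y ^ 2 = ∑ a ∈ C, ∑ b ∈ C, dotChar y (a + b) := fun y => by
    simp_rw [charSum, sq, sum_mul_sum, AddChar.map_add_eq_mul]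
  have hadd : ∀ a b : Fin d → ZMod 2, a + b = 0 ↔ a = b := fun a b => by
    simp only [funext_iff, Pi.add_apply, Pi.zero_apply, CharTwo.add_eq_zero]
  simp_rw [h]
  rw [sum_comm]
  simp_rw [sum_comm (s := univ), sum_dotChar, hadd]
  simp

theorem mulVec_addCayleyAdj_dotChar {d : ℕ} (C : Finset (Fin d → ZMod 2))
    (y : Fin d → ZMod 2) :
    addCayleyAdj C *ᵥ (fun x => (dotChar y x : ℝ)) =
      (charSum C y : ℝ) • fun x => (dotChar y x : ℝ) := by
  funext g
  simp only [mulVec, dotProduct, addCayleyAdj, of_apply, Pi.smul_apply, smul_eq_mul]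
  rw [← Equiv.sum_comp (Equiv.addRight g)]
  simp [AddChar.map_add_eq_mul, charSum, sum_mul]

theorem card_filter_charSum_le_finrank {d : ℕ} (C : Finset (Fin d → ZMod 2)) (v : ℤ) :
    #{y | charSum C y = v} ≤
      Module.finrank ℝ (Module.End.eigenspace (toLin' (addCayleyAdj C)) (v : ℝ)) := by
  let χ : (Fin d → ZMod 2) → AddChar (Fin d → ZMod 2) ℝ := fun y =>
    (Int.castRingHom ℝ : ℤ →* ℝ).compAddChar (dotChar y)
  have hχ : Function.Injective χ := fun y z h => dotChar_injective d <| by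
    ext x
    have := DFunLike.congr_fun h x
    simpa [χ] using this
  have hli := (AddChar.linearIndependent (Fin d → ZMod 2) ℝ).comp χ hχ
  have hli' := hli.comp (fun y : {y // charSum C y = v} => y.1) Subtype.val_injective
  let b : {y // charSum C y = v} → Module.End.eigenspace (toLin' (addCayleyAdj C)) (v : ℝ) :=
    fun y => ⟨χ y.1, by
      rw [Module.End.mem_eigenspace_iff, toLin'_apply]
      have := mulVec_addCayleyAdj_dotChar C y.1
      rwa [y.2] at this⟩
  have hb : LinearIndependent ℝ b := LinearIndependent.of_comp (Submodule.subtype _) hli'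
  simpa [Fintype.card_subtype] using hb.fintype_card_le_finrank

theorem stmt14 (d : ℕ) (hd : 3 ≤ d) (C : Finset (Fin d → ZMod 2)) (h0 : 0 ∉ C) :
    ∃ μ : ℝ, Module.End.HasEigenvalue (Matrix.toLin' (addCayleyAdj C)) μ ∧
      (2 : ℝ) ^ ((d : ℝ) / 2) <
        Module.finrank ℝ (Module.End.eigenspace (Matrix.toLin' (addCayleyAdj C)) μ) := by
  obtain ⟨v, hv⟩ := exists_two_pow_lt_card_sq (univ.erase (0 : Fin d → ZMod 2)) (charSum C) #C d hd
    (by rw [card_erase_of_mem (mem_univ _), Nat.cast_sub (by simp [Nat.one_le_two_pow])]; simp)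
    (fun y _ => charSum_modEq C y)
    (by
      have h := add_sum_erase univ (fun y => charSum C y ^ 2) (mem_univ 0)
      simp only [sum_charSum_sq, charSum_zero] at h
      linarith)
  have hle : #{y ∈ univ.erase (0 : Fin d → ZMod 2) | charSum C y = v} ≤
      Module.finrank ℝ (Module.End.eigenspace (toLin' (addCayleyAdj C)) (v : ℝ)) :=
    (card_le_card (filter_subset_filter _ (erase_subset _ _))).trans
      (card_filter_charSum_le_finrank C v)
  have hlt := hv.trans_le (Nat.pow_le_pow_left hle 2)
  refine ⟨v, ?_, ?_⟩
  · rw [Module.End.hasEigenvalue_iff]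
    intro hbot
    rw [hbot, finrank_bot] at hlt
    simp at hlt
  · refine lt_of_pow_lt_pow_left₀ 2 (Nat.cast_nonneg _) ?_
    rw [← Real.rpow_natCast, ← Real.rpow_mul (by norm_num)]
    norm_num
    exact_mod_cast hlt
end
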